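/- arXiv:2103.12931 — 4 statements merged into one kernel-verified Lean document; each statement's English description precedes it below -/
import Mathlib

section
/- Let (x*,λ*) be a saddle point of L, assume the scaling condition holds, and let (x,λ) be a global solution of the primal-dual dynamical system. Then the trajectory is bounded: sup_{t ≥ t₀} ‖x(t)‖ < ∞, sup_{t ≥ t₀} ‖ẋ(t)‖ < ∞, and sup_{t ≥ t₀} ‖λ(t)‖ < ∞. -/
open scoped RealInnerProductSpace
open MeasureTheory Set

noncomputable def Lagr {n m : ℕ} (f : EuclideanSpace ℝ (Fin n) → ℝ)
    (A : EuclideanSpace ℝ (Fin n) →L[ℝ] EuclideanSpace ℝ (Fin m))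
    (b : EuclideanSpace ℝ (Fin m))
    (x : EuclideanSpace ℝ (Fin n)) (lam : EuclideanSpace ℝ (Fin m)) : ℝ :=
  f x + ⟪lam, A x - b⟫

noncomputable def AugLagr {n m : ℕ} (f : EuclideanSpace ℝ (Fin n) → ℝ)
    (A : EuclideanSpace ℝ (Fin n) →L[ℝ] EuclideanSpace ℝ (Fin m))
    (b : EuclideanSpace ℝ (Fin m)) (σ : ℝ)
    (x : EuclideanSpace ℝ (Fin n)) (lam : EuclideanSpace ℝ (Fin m)) : ℝ :=
  Lagr f A b x lam + σ / 2 * ‖A x - b‖ ^ 2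

def IsSaddlePoint {n m : ℕ} (f : EuclideanSpace ℝ (Fin n) → ℝ)
    (A : EuclideanSpace ℝ (Fin n) →L[ℝ] EuclideanSpace ℝ (Fin m))
    (b : EuclideanSpace ℝ (Fin m))
    (xs : EuclideanSpace ℝ (Fin n)) (ls : EuclideanSpace ℝ (Fin m)) : Prop :=
  ∀ x lam, Lagr f A b xs lam ≤ Lagr f A b xs ls ∧ Lagr f A b xs ls ≤ Lagr f A b x ls

/-- The first-order characterization of convexity: the graph of `f` lies above its tangents. -/
theorem ConvexOn.add_inner_gradient_le {E : Type*} [NormedAddCommGroup E] [InnerProductSpace ℝ E]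
    [CompleteSpace E] {f : E → ℝ} (hf : ConvexOn ℝ univ f) {x : E}
    (hd : DifferentiableAt ℝ f x) (y : E) : f x + ⟪gradient f x, y - x⟫ ≤ f y := by
  have hline : ConvexOn ℝ univ (f ∘ AffineMap.lineMap (k := ℝ) x y) := by
    simpa using hf.comp_affineMap (AffineMap.lineMap (k := ℝ) x y)
  have hgrad : HasFDerivAt f (InnerProductSpace.toDual ℝ E (gradient f x))
      (AffineMap.lineMap (k := ℝ) x y (0 : ℝ)) := by
    simpa using hd.hasGradientAt.hasFDerivAt
  have hderiv := hgrad.comp_hasDerivAt (0 : ℝ) AffineMap.hasDerivAt_lineMap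
  have h := hline.le_slope_of_hasDerivAt (mem_univ 0) (mem_univ 1) one_pos hderiv
  simp only [slope_def_field, Function.comp_apply, AffineMap.lineMap_apply_one,
    AffineMap.lineMap_apply_zero, sub_zero, div_one, InnerProductSpace.toDual_apply_apply] at h
  linarith

theorem IsSaddlePoint.map_eq {n m : ℕ} {f : EuclideanSpace ℝ (Fin n) → ℝ}
    {A : EuclideanSpace ℝ (Fin n) →L[ℝ] EuclideanSpace ℝ (Fin m)}
    {b : EuclideanSpace ℝ (Fin m)}
    {xs : EuclideanSpace ℝ (Fin n)} {ls : EuclideanSpace ℝ (Fin m)}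
    (h : IsSaddlePoint f A b xs ls) : A xs = b := by
  have h1 := (h xs (ls + (A xs - b))).1
  simp only [Lagr, inner_add_left, real_inner_self_eq_norm_sq] at h1
  have h2 : ‖A xs - b‖ ^ 2 = 0 := le_antisymm (by linarith) (sq_nonneg _)
  exact sub_eq_zero.mp (norm_eq_zero.mp (pow_eq_zero_iff two_ne_zero |>.mp h2))

theorem IsSaddlePoint.le_lagr {n m : ℕ} {f : EuclideanSpace ℝ (Fin n) → ℝ}
    {A : EuclideanSpace ℝ (Fin n) →L[ℝ] EuclideanSpace ℝ (Fin m)}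
    {b : EuclideanSpace ℝ (Fin m)}
    {xs : EuclideanSpace ℝ (Fin n)} {ls : EuclideanSpace ℝ (Fin m)}
    (h : IsSaddlePoint f A b xs ls) (x : EuclideanSpace ℝ (Fin n)) :
    f xs ≤ Lagr f A b x ls := by
  simpa [Lagr, h.map_eq] using (h x ls).2

/-- A bound on a positive multiple of the squared norm bounds the norm. -/
theorem norm_le_sqrt_div {E : Type*} [SeminormedAddCommGroup E] {v : E} {c K : ℝ} (hc : 0 < c)
    (h : c * ‖v‖ ^ 2 ≤ K) : ‖v‖ ≤ √(K / c) :=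
  Real.le_sqrt_of_sq_le ((le_div_iff₀ hc).mpr (by linarith))

theorem norm_le_add_of_norm_sub_le {E : Type*} [SeminormedAddCommGroup E] {u v : E} {C : ℝ}
    (h : ‖u - v‖ ≤ C) : ‖u‖ ≤ C + ‖v‖ := by
  linarith [norm_le_norm_sub_add u v]

theorem trajectory_bounded
    {n m : ℕ}
    (f : EuclideanSpace ℝ (Fin n) → ℝ)
    (hf_conv : ConvexOn ℝ Set.univ f)
    (hf_smooth : ContDiff ℝ 1 f)
    (A : EuclideanSpace ℝ (Fin n) →L[ℝ] EuclideanSpace ℝ (Fin m))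
    (b : EuclideanSpace ℝ (Fin m))
    (t₀ γ δ σ : ℝ) (ht₀ : 0 ≤ t₀) (hγ : 0 < γ) (hδ : 0 < δ) (hσ : 0 < σ)
    (β β' : ℝ → ℝ)
    (hβpos : ∀ t ∈ Ici t₀, 0 < β t)
    (hβderiv : ∀ t ∈ Ici t₀, HasDerivWithinAt β (β' t) (Ici t₀) t)
    (hβ'cont : ContinuousOn β' (Ici t₀))
    (xs : EuclideanSpace ℝ (Fin n)) (ls : EuclideanSpace ℝ (Fin m))
    (hsaddle : IsSaddlePoint f A b xs ls)
    (hscale : ∀ t ∈ Ici t₀, β' t ≤ β t / δ) (hscale' : 1 / δ < γ)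
    (x x' x'' : ℝ → EuclideanSpace ℝ (Fin n))
    (lam lam' : ℝ → EuclideanSpace ℝ (Fin m))
    (hx : ∀ t ∈ Ici t₀, HasDerivWithinAt x (x' t) (Ici t₀) t)
    (hx' : ∀ t ∈ Ici t₀, HasDerivWithinAt x' (x'' t) (Ici t₀) t)
    (hx''cont : ContinuousOn x'' (Ici t₀))
    (hlam : ∀ t ∈ Ici t₀, HasDerivWithinAt lam (lam' t) (Ici t₀) t)
    (hlam'cont : ContinuousOn lam' (Ici t₀))
    (hode1 : ∀ t ∈ Ici t₀, x'' t + γ • x' t =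
      -(β t) • (gradient f (x t) + A.adjoint (lam t) + σ • A.adjoint (A (x t) - b)))
    (hode2 : ∀ t ∈ Ici t₀, lam' t = β t • (A (x t + δ • x' t) - b))
    :
    (∃ C : ℝ, ∀ t ∈ Ici t₀, ‖x t‖ ≤ C) ∧
    (∃ C : ℝ, ∀ t ∈ Ici t₀, ‖x' t‖ ≤ C) ∧
    (∃ C : ℝ, ∀ t ∈ Ici t₀, ‖lam t‖ ≤ C) := by
  have hAxs := hsaddle.map_eq
  have hfd : Differentiable ℝ f := hf_smooth.differentiable one_ne_zero
  have hδγ : 0 < δ * γ - 1 := by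
    have := (div_lt_iff₀ hδ).mp hscale'
    linarith
  -- The Lyapunov function, nonincreasing along the trajectory.
  let E : ℝ → ℝ := fun t =>
    δ ^ 2 * (β t * (f (x t) - f xs + ⟪ls, A (x t) - b⟫ + σ / 2 * ‖A (x t) - b‖ ^ 2))
      + 1 / 2 * ‖x t - xs + δ • x' t‖ ^ 2 + (δ * γ - 1) / 2 * ‖x t - xs‖ ^ 2
      + δ / 2 * ‖lam t - ls‖ ^ 2
  let E' : ℝ → ℝ := fun t =>
    δ ^ 2 * (β' t * (f (x t) - f xs + ⟪ls, A (x t) - b⟫ + σ / 2 * ‖A (x t) - b‖ ^ 2)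
        + β t * (⟪gradient f (x t), x' t⟫ + ⟪ls, A (x' t)⟫ + σ / 2 * (2 * ⟪A (x t) - b, A (x' t)⟫)))
      + 1 / 2 * (2 * ⟪x t - xs + δ • x' t, x' t + δ • x'' t⟫)
      + (δ * γ - 1) / 2 * (2 * ⟪x t - xs, x' t⟫)
      + δ / 2 * (2 * ⟪lam t - ls, lam' t⟫)
  have hE : ∀ t ∈ Ici t₀, HasDerivWithinAt E (E' t) (Ici t₀) t := by
    intro t ht
    have hx₁ := hx t ht
    have hf₁ : HasDerivWithinAt (fun s => f (x s)) ⟪gradient f (x t), x' t⟫ (Ici t₀) t :=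
      (hfd (x t)).hasGradientAt.hasFDerivAt.comp_hasDerivWithinAt t hx₁
    have hw : HasDerivWithinAt (fun s => A (x s) - b) (A (x' t)) (Ici t₀) t :=
      (A.hasFDerivAt.comp_hasDerivWithinAt t hx₁).sub_const b
    have hl : HasDerivWithinAt (fun s => ⟪ls, A (x s) - b⟫) ⟪ls, A (x' t)⟫ (Ici t₀) t := by
      simpa using (hasDerivWithinAt_const t (Ici t₀) ls).inner ℝ hw
    have hy := hx₁.sub_const xs
    exact ((((hβderiv t ht).mul (((hf₁.sub_const (f xs)).add hl).add
      (hw.norm_sq.const_mul (σ / 2)))).const_mul (δ ^ 2)).add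
      ((hy.add ((hx' t ht).const_smul δ)).norm_sq.const_mul (1 / 2))).add
      (hy.norm_sq.const_mul ((δ * γ - 1) / 2)) |>.add
      (((hlam t ht).sub_const ls).norm_sq.const_mul (δ / 2))
  have hgap : ∀ t, 0 ≤ f (x t) - f xs + ⟪ls, A (x t) - b⟫ + σ / 2 * ‖A (x t) - b‖ ^ 2 := by
    intro t
    have h := hsaddle.le_lagr (x t)
    rw [Lagr] at h
    have : 0 ≤ σ / 2 * ‖A (x t) - b‖ ^ 2 := by positivity
    linarith
  have hE'_nonpos : ∀ t ∈ Ici t₀, E' t ≤ 0 := by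
    intro t ht
    have hβ := hβpos t ht
    have hx'' : x'' t = -(γ • x' t) - β t • (gradient f (x t) + A.adjoint (lam t)
        + σ • A.adjoint (A (x t) - b)) := by
      rw [eq_sub_of_add_eq (hode1 t ht), neg_smul]
      abel
    have hgrad := hf_conv.add_inner_gradient_le (hfd (x t)) xs
    have hAy : A (x t - xs) = A (x t) - b := by rw [map_sub, hAxs]
    have hlam' : lam' t = β t • ((A (x t) - b) + δ • A (x' t)) := by
      rw [hode2 t ht, map_add, map_smul, add_sub_right_comm]
    have hscale₁ : 0 ≤ (β t - δ * β' t) *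
        (f (x t) - f xs + ⟪ls, A (x t) - b⟫ + σ / 2 * ‖A (x t) - b‖ ^ 2) := by
      refine mul_nonneg ?_ (hgap t)
      have := (le_div_iff₀ hδ).mp (hscale t ht)
      linarith
    have hgrad₁ : 0 ≤ β t * (⟪x t - xs, gradient f (x t)⟫ - (f (x t) - f xs)) := by
      refine mul_nonneg hβ.le ?_
      rw [← neg_sub (x t) xs, inner_neg_right, real_inner_comm] at hgrad
      linarith
    have hσw : 0 ≤ β t * (σ / 2 * ‖A (x t) - b‖ ^ 2) := by positivity
    have key : E' t = -δ * ((β t - δ * β' t) *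
          (f (x t) - f xs + ⟪ls, A (x t) - b⟫ + σ / 2 * ‖A (x t) - b‖ ^ 2)
        + β t * (⟪x t - xs, gradient f (x t)⟫ - (f (x t) - f xs))
        + β t * (σ / 2 * ‖A (x t) - b‖ ^ 2)) - δ * (δ * γ - 1) * ‖x' t‖ ^ 2 := by
      simp only [E', hx'', hlam']
      generalize hy : x t - xs = y at *
      generalize hw : A (x t) - b = w at *
      simp only [inner_add_left, inner_add_right, inner_sub_left, inner_sub_right, inner_neg_right,
        real_inner_smul_left, real_inner_smul_right, ContinuousLinearMap.adjoint_inner_right,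
        smul_add, smul_sub, smul_neg, map_smul, hAy, real_inner_self_eq_norm_sq]
      rw [real_inner_comm (gradient f (x t)) (x' t), real_inner_comm (lam t) w,
        real_inner_comm (lam t) (A (x' t)), real_inner_comm w (A (x' t))]
      ring
    rw [key]
    have : 0 ≤ δ * (δ * γ - 1) * ‖x' t‖ ^ 2 := by positivity
    nlinarith
  have hanti : AntitoneOn E (Ici t₀) :=
    antitoneOn_of_hasDerivWithinAt_nonpos (convex_Ici t₀)
      (fun t ht => (hE t ht).continuousWithinAt)
      (fun t ht => (hE t (interior_subset ht)).mono interior_subset)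
      (fun t ht => hE'_nonpos t (interior_subset ht))
  have hbound : ∀ t ∈ Ici t₀, 1 / 2 * ‖x t - xs + δ • x' t‖ ^ 2 ≤ E t₀ ∧
      (δ * γ - 1) / 2 * ‖x t - xs‖ ^ 2 ≤ E t₀ ∧ δ / 2 * ‖lam t - ls‖ ^ 2 ≤ E t₀ := by
    intro t ht
    have h : E t ≤ E t₀ := hanti self_mem_Ici ht ht
    have h0 : 0 ≤ δ ^ 2 * (β t * (f (x t) - f xs + ⟪ls, A (x t) - b⟫
        + σ / 2 * ‖A (x t) - b‖ ^ 2)) :=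
      mul_nonneg (sq_nonneg δ) (mul_nonneg (hβpos t ht).le (hgap t))
    have h1 : 0 ≤ 1 / 2 * ‖x t - xs + δ • x' t‖ ^ 2 := by positivity
    have h2 : 0 ≤ (δ * γ - 1) / 2 * ‖x t - xs‖ ^ 2 := by positivity
    have h3 : 0 ≤ δ / 2 * ‖lam t - ls‖ ^ 2 := by positivity
    simp only [E] at h ⊢
    refine ⟨?_, ?_, ?_⟩ <;> linarith
  have hxb : ∀ t ∈ Ici t₀, ‖x t - xs‖ ≤ √(E t₀ / ((δ * γ - 1) / 2)) := fun t ht =>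
    norm_le_sqrt_div (half_pos hδγ) (hbound t ht).2.1
  refine ⟨⟨_, fun t ht => norm_le_add_of_norm_sub_le (hxb t ht)⟩,
    ⟨(√(E t₀ / (1 / 2)) + √(E t₀ / ((δ * γ - 1) / 2))) / δ, fun t ht => ?_⟩,
    ⟨_, fun t ht => norm_le_add_of_norm_sub_le
      (norm_le_sqrt_div (half_pos hδ) (hbound t ht).2.2)⟩⟩
  rw [le_div_iff₀ hδ]
  calc ‖x' t‖ * δ = ‖δ • x' t‖ := by rw [norm_smul, Real.norm_of_nonneg hδ.le, mul_comm]
    _ = ‖(x t - xs + δ • x' t) - (x t - xs)‖ := by rw [add_sub_cancel_left]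
    _ ≤ ‖x t - xs + δ • x' t‖ + ‖x t - xs‖ := norm_sub_le _ _
    _ ≤ _ := add_le_add (norm_le_sqrt_div one_half_pos (hbound t ht).1) (hxb t ht)
end

section
/- Let (x*,λ*) be a saddle point of L, assume the scaling condition holds, and let (x,λ) be a global solution of the primal-dual dynamical system. Then ∫_{t₀}^{∞} β(t) ‖Ax(t) − b‖² dt < +∞. -/
open scoped RealInnerProductSpace
open MeasureTheory Set

theorem ConvexOn.inner_gradient_le_sub {E : Type*} [NormedAddCommGroup E] [InnerProductSpace ℝ E]
    [CompleteSpace E] {f : E → ℝ} (hf : ConvexOn ℝ univ f) {x : E}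
    (hd : DifferentiableAt ℝ f x) (y : E) :
    ⟪gradient f x, y - x⟫ ≤ f y - f x := by
  have hline : HasDerivAt (AffineMap.lineMap x y : ℝ → E) (y - x) 0 :=
    AffineMap.hasDerivAt_lineMap
  have hgrad : HasFDerivAt f (InnerProductSpace.toDual ℝ E (gradient f x))
      (AffineMap.lineMap x y (0 : ℝ)) := by
    rw [AffineMap.lineMap_apply_zero]
    exact hd.hasGradientAt.hasFDerivAt
  have hcomp := hgrad.comp_hasDerivAt (0 : ℝ) hline
  have hconv : ConvexOn ℝ univ (f ∘ (AffineMap.lineMap x y : ℝ → E)) :=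
    hf.comp_affineMap (AffineMap.lineMap x y)
  simpa [slope_def_field] using
    hconv.le_slope_of_hasDerivAt (mem_univ 0) (mem_univ 1) one_pos hcomp

/-- A nonnegative function dominated by the dissipation of a nonnegative energy is integrable. -/
theorem integrableOn_Ici_of_hasDerivWithinAt_le_neg {φ E E' : ℝ → ℝ} {a : ℝ}
    (hφ : ContinuousOn φ (Ici a)) (hφ_nonneg : ∀ t ∈ Ici a, 0 ≤ φ t)
    (hE : ∀ t ∈ Ici a, HasDerivWithinAt E (E' t) (Ici a) t)
    (hE_nonneg : ∀ t ∈ Ici a, 0 ≤ E t) (hle : ∀ t ∈ Ici a, E' t ≤ -φ t) :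
    IntegrableOn φ (Ici a) := by
  rw [integrableOn_Ici_iff_integrableOn_Ioi]
  have hint (T : ℝ) : IntegrableOn φ (Icc a T) :=
    (hφ.mono Icc_subset_Ici_self).integrableOn_Icc
  refine integrableOn_Ioi_of_intervalIntegral_norm_bounded (b := id) (l := Filter.atTop) (E a) a
    (fun T => (hint T).mono_set Ioc_subset_Icc_self) Filter.tendsto_id ?_
  filter_upwards [Filter.eventually_ge_atTop a] with T hT
  have hnorm : ∫ t in a..T, ‖φ t‖ = ∫ t in a..T, φ t := by
    refine intervalIntegral.integral_congr fun t ht => ?_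
    rw [uIcc_of_le hT] at ht
    exact Real.norm_of_nonneg (hφ_nonneg t ht.1)
  have hmain : ∫ t in a..T, φ t ≤ -E T - -E a :=
    intervalIntegral.integral_le_sub_of_hasDeriv_right_of_le hT
      (fun t ht => ((hE t ht.1).continuousWithinAt.mono Icc_subset_Ici_self).neg)
      (fun t ht => ((hE t ht.1.le).mono fun s hs => ht.1.le.trans (le_of_lt hs)).neg)
      (hint T) (fun t ht => by linarith [hle t ht.1.le])
  have := hE_nonneg T hT
  simp only [id]
  linarith

theorem HasDerivWithinAt.augLagr_comp {n m : ℕ} {f : EuclideanSpace ℝ (Fin n) → ℝ}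
    {A : EuclideanSpace ℝ (Fin n) →L[ℝ] EuclideanSpace ℝ (Fin m)}
    {b l : EuclideanSpace ℝ (Fin m)} {σ t : ℝ} {s : Set ℝ}
    {x : ℝ → EuclideanSpace ℝ (Fin n)} {v : EuclideanSpace ℝ (Fin n)}
    (hf : DifferentiableAt ℝ f (x t)) (hx : HasDerivWithinAt x v s t) :
    HasDerivWithinAt (fun t => AugLagr f A b σ (x t) l)
      (⟪gradient f (x t), v⟫ + ⟪l, A v⟫ + σ * ⟪A (x t) - b, A v⟫) s t := by
  have hA : HasDerivWithinAt (fun t => A (x t) - b) (A v) s t :=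
    (A.hasFDerivAt.comp_hasDerivWithinAt t hx).sub_const b
  have hfx : HasDerivWithinAt (fun t => f (x t)) ⟪gradient f (x t), v⟫ s t :=
    hf.hasGradientAt.hasFDerivAt.comp_hasDerivWithinAt t hx
  have hl := (hasDerivWithinAt_const t s l).inner ℝ hA
  refine ((hfx.add hl).add (hA.norm_sq.const_mul (σ / 2))).congr_deriv ?_
  simp only [inner_zero_left]
  ring

/-- The rate of change of the energy along a trajectory, with all inner products expanded. -/
theorem energy_rate_eq {n m : ℕ}
    (A : EuclideanSpace ℝ (Fin n) →L[ℝ] EuclideanSpace ℝ (Fin m))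
    (u v a g : EuclideanSpace ℝ (Fin n)) (p l : EuclideanSpace ℝ (Fin m)) (γ δ σ β : ℝ)
    (ha : a + γ • v = -β • (g + A.adjoint p + σ • A.adjoint (A u))) :
    δ ^ 2 * β * (⟪g, v⟫ + ⟪l, A v⟫ + σ * ⟪A u, A v⟫) + ⟪u + δ • v, v + δ • a⟫
        + (δ * γ - 1) * ⟪u, v⟫ + δ * ⟪p - l, β • A (u + δ • v)⟫
      = -(δ * β) * (⟪g, u⟫ + ⟪l, A u⟫ + σ * ‖A u‖ ^ 2) - δ * (δ * γ - 1) * ‖v‖ ^ 2 := by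
  have ha' : a = -β • (g + A.adjoint p + σ • A.adjoint (A u)) - γ • v := by
    rw [← ha]; abel
  rw [ha']
  simp only [map_add, map_smul, inner_add_left, inner_add_right, inner_sub_left, inner_sub_right,
    inner_smul_left, inner_smul_right, smul_add, smul_sub, ContinuousLinearMap.adjoint_inner_right,
    ← real_inner_self_eq_norm_sq, RCLike.conj_to_real]
  rw [real_inner_comm v u, real_inner_comm g u, real_inner_comm g v, real_inner_comm p (A u),
    real_inner_comm p (A v), real_inner_comm (A u) (A v)]
  ring

theorem integral_feasibility_finite
    {n m : ℕ}
    (f : EuclideanSpace ℝ (Fin n) → ℝ)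
    (hf_conv : ConvexOn ℝ Set.univ f)
    (hf_smooth : ContDiff ℝ 1 f)
    (A : EuclideanSpace ℝ (Fin n) →L[ℝ] EuclideanSpace ℝ (Fin m))
    (b : EuclideanSpace ℝ (Fin m))
    (t₀ γ δ σ : ℝ) (ht₀ : 0 ≤ t₀) (hγ : 0 < γ) (hδ : 0 < δ) (hσ : 0 < σ)
    (β β' : ℝ → ℝ)
    (hβpos : ∀ t ∈ Ici t₀, 0 < β t)
    (hβderiv : ∀ t ∈ Ici t₀, HasDerivWithinAt β (β' t) (Ici t₀) t)
    (hβ'cont : ContinuousOn β' (Ici t₀))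
    (xs : EuclideanSpace ℝ (Fin n)) (ls : EuclideanSpace ℝ (Fin m))
    (hsaddle : IsSaddlePoint f A b xs ls)
    (hscale : ∀ t ∈ Ici t₀, β' t ≤ β t / δ) (hscale' : 1 / δ < γ)
    (x x' x'' : ℝ → EuclideanSpace ℝ (Fin n))
    (lam lam' : ℝ → EuclideanSpace ℝ (Fin m))
    (hx : ∀ t ∈ Ici t₀, HasDerivWithinAt x (x' t) (Ici t₀) t)
    (hx' : ∀ t ∈ Ici t₀, HasDerivWithinAt x' (x'' t) (Ici t₀) t)
    (hx''cont : ContinuousOn x'' (Ici t₀))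
    (hlam : ∀ t ∈ Ici t₀, HasDerivWithinAt lam (lam' t) (Ici t₀) t)
    (hlam'cont : ContinuousOn lam' (Ici t₀))
    (hode1 : ∀ t ∈ Ici t₀, x'' t + γ • x' t =
      -(β t) • (gradient f (x t) + A.adjoint (lam t) + σ • A.adjoint (A (x t) - b)))
    (hode2 : ∀ t ∈ Ici t₀, lam' t = β t • (A (x t + δ • x' t) - b))
    :
    IntegrableOn (fun t => β t * ‖A (x t) - b‖ ^ 2) (Ici t₀) := by
  have hA : A xs = b := hsaddle.map_eq
  have hd : Differentiable ℝ f := hf_smooth.differentiable one_ne_zero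
  have hγδ : 0 < δ * γ - 1 := by
    rw [div_lt_iff₀ hδ] at hscale'
    linarith
  have hr (y : EuclideanSpace ℝ (Fin n)) : A y - b = A (y - xs) := by rw [map_sub, hA]
  set G : ℝ → ℝ := fun t => AugLagr f A b σ (x t) ls - f xs with hG
  have hG_nonneg (t : ℝ) : 0 ≤ G t := by
    have h2 := (hsaddle (x t) ls).2
    simp only [Lagr, hA, sub_self, inner_zero_right, add_zero] at h2
    simp only [hG, AugLagr, Lagr]
    have : 0 ≤ σ / 2 * ‖A (x t) - b‖ ^ 2 := by positivity
    linarith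
  have hGu (t : ℝ) : G t + σ / 2 * ‖A (x t - xs)‖ ^ 2 ≤
      ⟪gradient f (x t), x t - xs⟫ + ⟪ls, A (x t - xs)⟫ + σ * ‖A (x t - xs)‖ ^ 2 := by
    have h := hf_conv.inner_gradient_le_sub (hd (x t)) xs
    rw [← neg_sub (x t) xs, inner_neg_right] at h
    simp only [hG, AugLagr, Lagr, hr]
    linarith
  have hE (t : ℝ) (ht : t ∈ Ici t₀) :
      HasDerivWithinAt (fun t => δ ^ 2 * (β t * G t) + 1 / 2 * ‖x t - xs + δ • x' t‖ ^ 2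
          + (δ * γ - 1) / 2 * ‖x t - xs‖ ^ 2 + δ / 2 * ‖lam t - ls‖ ^ 2)
        (δ ^ 2 * β' t * G t - (δ * β t) * (⟪gradient f (x t), x t - xs⟫ + ⟪ls, A (x t - xs)⟫
          + σ * ‖A (x t - xs)‖ ^ 2) - δ * (δ * γ - 1) * ‖x' t‖ ^ 2) (Ici t₀) t := by
    have hu := (hx t ht).sub_const xs
    have hGt := ((hx t ht).augLagr_comp (A := A) (b := b) (l := ls) (σ := σ)
      (hd (x t))).sub_const (f xs)
    have hrate := energy_rate_eq A (x t - xs) (x' t) (x'' t) (gradient f (x t)) (lam t) ls γ δ σ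
      (β t) (by rw [hode1 t ht, hr])
    have hlamt : lam' t = β t • A (x t - xs + δ • x' t) := by
      rw [hode2 t ht, hr, add_sub_right_comm]
    have := (((((hβderiv t ht).mul hGt).const_mul (δ ^ 2)).add
      ((hu.add ((hx' t ht).const_smul δ)).norm_sq.const_mul (1 / 2))).add
      (hu.norm_sq.const_mul ((δ * γ - 1) / 2))).add
      (((hlam t ht).sub_const ls).norm_sq.const_mul (δ / 2))
    refine this.congr_deriv ?_
    simp only [hlamt, hr, Pi.add_apply, Pi.smul_apply, hG] at hrate ⊢
    linear_combination hrate
  have hφ : IntegrableOn (fun t => δ * σ / 2 * (β t * ‖A (x t) - b‖ ^ 2)) (Ici t₀) := by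
    refine integrableOn_Ici_of_hasDerivWithinAt_le_neg ?_ ?_ hE ?_ ?_
    · have hβc : ContinuousOn β (Ici t₀) := fun t ht => (hβderiv t ht).continuousWithinAt
      have hxc : ContinuousOn x (Ici t₀) := fun t ht => (hx t ht).continuousWithinAt
      fun_prop
    · intro t ht
      have := hβpos t ht
      positivity
    · intro t ht
      have := hβpos t ht
      have := hG_nonneg t
      positivity
    · intro t ht
      have h1 : δ * β' t ≤ β t := by
        have := hscale t ht
        rw [le_div_iff₀ hδ] at this
        linarith
      have h2 := mul_le_mul_of_nonneg_right h1 (mul_nonneg hδ.le (hG_nonneg t))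
      have h3 := mul_le_mul_of_nonneg_left (hGu t) (mul_pos hδ (hβpos t ht)).le
      have h4 : 0 ≤ δ * (δ * γ - 1) * ‖x' t‖ ^ 2 := by positivity
      rw [hr]
      linarith
  exact (integrable_const_mul_iff (by positivity : δ * σ / 2 ≠ 0).isUnit _).mp hφ
end

section
/- Let (x*,λ*) be a saddle point of L, assume the scaling condition holds, and let (x,λ) be a global solution of the primal-dual dynamical system. Then ∫_{t₀}^{∞} ‖ẋ(t)‖² dt < +∞. -/
open scoped RealInnerProductSpace
open MeasureTheory Set

theorem ConvexOn.sub_le_inner_gradient {E : Type*} [NormedAddCommGroup E] [InnerProductSpace ℝ E]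
    [CompleteSpace E] {f : E → ℝ} (hf : ConvexOn ℝ univ f) {x : E}
    (hd : DifferentiableAt ℝ f x) (y : E) : f x - f y ≤ ⟪gradient f x, x - y⟫ := by
  have hc : ConvexOn ℝ univ (fun s : ℝ => f (AffineMap.lineMap x y s)) := by
    exact hf.comp_affineMap (AffineMap.lineMap x y : ℝ →ᵃ[ℝ] E)
  have hline : HasDerivAt (fun s : ℝ => f (AffineMap.lineMap x y s)) (fderiv ℝ f x (y - x)) 0 := by
    have hfx : HasFDerivAt f (fderiv ℝ f x) (AffineMap.lineMap x y (0 : ℝ)) := by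
      simpa using hd.hasFDerivAt
    exact hfx.comp_hasDerivAt (0 : ℝ) AffineMap.hasDerivAt_lineMap
  have h := hc.le_slope_of_hasDerivAt (mem_univ 0) (mem_univ 1) one_pos hline
  simp only [slope_def_field, AffineMap.lineMap_apply_one, AffineMap.lineMap_apply_zero] at h
  have h' : fderiv ℝ f x (y - x) = -⟪gradient f x, x - y⟫ := by
    rw [inner_gradient_left, ← map_neg, neg_sub]
  rw [h'] at h
  linarith

theorem integrableOn_Ici_of_hasDerivWithinAt_le_neg_mul {E E' φ : ℝ → ℝ} {a c : ℝ} (hc : 0 < c)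
    (hE : ∀ t ∈ Ici a, HasDerivWithinAt E (E' t) (Ici a) t) (hE_nonneg : ∀ t ∈ Ici a, 0 ≤ E t)
    (hφ : ContinuousOn φ (Ici a)) (hφ_nonneg : ∀ t ∈ Ici a, 0 ≤ φ t)
    (hle : ∀ t ∈ Ici a, E' t ≤ -(c * φ t)) : IntegrableOn φ (Ici a) := by
  have hint (b : ℝ) : IntegrableOn φ (Icc a b) :=
    (hφ.mono Icc_subset_Ici_self).integrableOn_Icc
  rw [integrableOn_Ici_iff_integrableOn_Ioi]
  refine integrableOn_Ioi_of_intervalIntegral_norm_bounded (E a / c) a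
    (fun b : ℝ => (hint b).mono_set Ioc_subset_Icc_self) Filter.tendsto_id ?_
  filter_upwards [Filter.eventually_ge_atTop a] with b hab
  have hnorm : ∫ t in a..b, ‖φ t‖ = ∫ t in a..b, φ t := by
    refine intervalIntegral.integral_congr fun t ht => ?_
    rw [uIcc_of_le hab] at ht
    exact Real.norm_of_nonneg (hφ_nonneg t ht.1)
  have hmain := intervalIntegral.integral_le_sub_of_hasDeriv_right_of_le (g := fun t => -E t)
    (g' := fun t => -E' t) (φ := fun t => c * φ t) hab
    (fun t ht => ((hE t ht.1).continuousWithinAt.mono Icc_subset_Ici_self).neg)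
    (fun t ht => ((hE t ht.1.le).mono fun s hs => ht.1.le.trans (le_of_lt hs)).neg)
    ((hint b).const_mul c) (fun t ht => by linarith [hle t ht.1.le])
  rw [intervalIntegral.integral_const_mul] at hmain
  have hb := hE_nonneg b hab
  rw [hnorm, le_div_iff₀ hc]
  linarith

theorem integral_velocity_finite
    {n m : ℕ}
    (f : EuclideanSpace ℝ (Fin n) → ℝ)
    (hf_conv : ConvexOn ℝ Set.univ f)
    (hf_smooth : ContDiff ℝ 1 f)
    (A : EuclideanSpace ℝ (Fin n) →L[ℝ] EuclideanSpace ℝ (Fin m))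
    (b : EuclideanSpace ℝ (Fin m))
    (t₀ γ δ σ : ℝ) (ht₀ : 0 ≤ t₀) (hγ : 0 < γ) (hδ : 0 < δ) (hσ : 0 < σ)
    (β β' : ℝ → ℝ)
    (hβpos : ∀ t ∈ Ici t₀, 0 < β t)
    (hβderiv : ∀ t ∈ Ici t₀, HasDerivWithinAt β (β' t) (Ici t₀) t)
    (hβ'cont : ContinuousOn β' (Ici t₀))
    (xs : EuclideanSpace ℝ (Fin n)) (ls : EuclideanSpace ℝ (Fin m))
    (hsaddle : IsSaddlePoint f A b xs ls)
    (hscale : ∀ t ∈ Ici t₀, β' t ≤ β t / δ) (hscale' : 1 / δ < γ)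
    (x x' x'' : ℝ → EuclideanSpace ℝ (Fin n))
    (lam lam' : ℝ → EuclideanSpace ℝ (Fin m))
    (hx : ∀ t ∈ Ici t₀, HasDerivWithinAt x (x' t) (Ici t₀) t)
    (hx' : ∀ t ∈ Ici t₀, HasDerivWithinAt x' (x'' t) (Ici t₀) t)
    (hx''cont : ContinuousOn x'' (Ici t₀))
    (hlam : ∀ t ∈ Ici t₀, HasDerivWithinAt lam (lam' t) (Ici t₀) t)
    (hlam'cont : ContinuousOn lam' (Ici t₀))
    (hode1 : ∀ t ∈ Ici t₀, x'' t + γ • x' t =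
      -(β t) • (gradient f (x t) + A.adjoint (lam t) + σ • A.adjoint (A (x t) - b)))
    (hode2 : ∀ t ∈ Ici t₀, lam' t = β t • (A (x t + δ • x' t) - b))
    :
    IntegrableOn (fun t => ‖x' t‖ ^ 2) (Ici t₀) := by
  have hAxs : A xs = b := hsaddle.map_eq
  have hγδ : 0 < δ * γ - 1 := by
    rw [div_lt_iff₀ hδ] at hscale'
    linarith
  have hF (t : ℝ) : 0 ≤ f (x t) + ⟪ls, A (x t) - b⟫ + σ / 2 * ‖A (x t) - b‖ ^ 2 - f xs := by
    have h := (hsaddle (x t) ls).2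
    simp only [Lagr, hAxs, sub_self, inner_zero_right, add_zero] at h
    have : 0 ≤ σ / 2 * ‖A (x t) - b‖ ^ 2 := by positivity
    linarith
  refine integrableOn_Ici_of_hasDerivWithinAt_le_neg_mul (c := (δ * γ - 1) * δ)
    (E := fun t => 1 / 2 * ‖(x t - xs) + δ • x' t‖ ^ 2 + δ / 2 * ‖lam t - ls‖ ^ 2
      + (δ * γ - 1) / 2 * ‖x t - xs‖ ^ 2
      + δ ^ 2 * (β t * (f (x t) + ⟪ls, A (x t) - b⟫ + σ / 2 * ‖A (x t) - b‖ ^ 2 - f xs)))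
    (E' := fun t => 1 / 2 * (2 * ⟪(x t - xs) + δ • x' t, x' t + δ • x'' t⟫)
      + δ / 2 * (2 * ⟪lam t - ls, lam' t⟫) + (δ * γ - 1) / 2 * (2 * ⟪x t - xs, x' t⟫)
      + δ ^ 2 * (β' t * (f (x t) + ⟪ls, A (x t) - b⟫ + σ / 2 * ‖A (x t) - b‖ ^ 2 - f xs)
        + β t * (⟪gradient f (x t), x' t⟫ + ⟪ls, A (x' t)⟫
          + σ / 2 * (2 * ⟪A (x t) - b, A (x' t)⟫))))
    (by positivity) ?_ ?_ ?_ (fun t _ => by positivity) ?_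
  · intro t ht
    have hv := (hx t ht).sub_const xs
    have hr : HasDerivWithinAt (fun t => A (x t) - b) (A (x' t)) (Ici t₀) t :=
      (A.hasFDerivAt.comp_hasDerivWithinAt t (hx t ht)).sub_const b
    have hfx : HasDerivWithinAt (fun t => f (x t)) ⟪gradient f (x t), x' t⟫ (Ici t₀) t := by
      rw [inner_gradient_left]
      exact ((hf_smooth.differentiable one_ne_zero) (x t)).hasFDerivAt.comp_hasDerivWithinAt t
        (hx t ht)
    have hlr : HasDerivWithinAt (fun t => ⟪ls, A (x t) - b⟫) ⟪ls, A (x' t)⟫ (Ici t₀) t := by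
      simpa using (hasDerivWithinAt_const t (Ici t₀) ls).inner ℝ hr
    exact (((((hv.add ((hx' t ht).const_smul δ)).norm_sq).const_mul (1 / 2)).add
      ((((hlam t ht).sub_const ls).norm_sq).const_mul (δ / 2))).add
      (hv.norm_sq.const_mul ((δ * γ - 1) / 2))).add
      (((hβderiv t ht).mul (((hfx.add hlr).add (hr.norm_sq.const_mul (σ / 2))).sub_const
        (f xs))).const_mul (δ ^ 2))
  · intro t ht
    have := hβpos t ht
    have := hF t
    positivity
  · exact fun t ht => ((hx' t ht).continuousWithinAt.norm).pow 2
  · intro t ht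
    have hβ := hβpos t ht
    have hconv := hf_conv.sub_le_inner_gradient
      ((hf_smooth.differentiable one_ne_zero) (x t)) xs
    have hAv : A (x t - xs) = A (x t) - b := by rw [map_sub, hAxs]
    have hode : x'' t = -(β t) • (gradient f (x t) + A.adjoint (lam t)
        + σ • A.adjoint (A (x t) - b)) - γ • x' t := eq_sub_of_add_eq (hode1 t ht)
    have hlam' : lam' t = β t • ((A (x t) - b) + δ • A (x' t)) := by
      rw [hode2 t ht, map_add, map_smul, add_sub_right_comm]
    have hident : 1 / 2 * (2 * ⟪(x t - xs) + δ • x' t, x' t + δ • x'' t⟫)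
        + δ / 2 * (2 * ⟪lam t - ls, lam' t⟫) + (δ * γ - 1) / 2 * (2 * ⟪x t - xs, x' t⟫)
        + δ ^ 2 * (β t * (⟪gradient f (x t), x' t⟫ + ⟪ls, A (x' t)⟫
          + σ / 2 * (2 * ⟪A (x t) - b, A (x' t)⟫)))
        = -((δ * γ - 1) * δ * ‖x' t‖ ^ 2) - δ * β t * (⟪gradient f (x t), x t - xs⟫
          + ⟪ls, A (x t) - b⟫ + σ * ‖A (x t) - b‖ ^ 2) := by
      rw [hode, hlam', inner_sub_left]
      generalize x t - xs = v at hAv ⊢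
      generalize A (x t) - b = r at hAv ⊢
      simp only [inner_add_left, inner_add_right, inner_sub_right, real_inner_smul_left,
        real_inner_smul_right, ContinuousLinearMap.adjoint_inner_right, hAv, map_smul,
        real_inner_self_eq_norm_sq]
      rw [real_inner_comm (gradient f (x t)) v, real_inner_comm (gradient f (x t)) (x' t),
        real_inner_comm (lam t) r, real_inner_comm (lam t) (A (x' t)),
        real_inner_comm r (A (x' t))]
      ring
    have hscale_mul : δ * β' t ≤ β t := by
      have := hscale t ht
      rw [le_div_iff₀ hδ] at this
      linarith
    have hgap := mul_le_mul_of_nonneg_left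
      (mul_le_mul_of_nonneg_right hscale_mul (hF t)) hδ.le
    have hsq : 0 ≤ σ / 2 * ‖A (x t) - b‖ ^ 2 := by positivity
    have hdescent : δ * β t * (f (x t) + ⟪ls, A (x t) - b⟫ + σ / 2 * ‖A (x t) - b‖ ^ 2 - f xs)
        ≤ δ * β t * (⟪gradient f (x t), x t - xs⟫ + ⟪ls, A (x t) - b⟫
          + σ * ‖A (x t) - b‖ ^ 2) :=
      mul_le_mul_of_nonneg_left (by linarith) (by positivity)
    linarith
end

section
/- Let t₀ ≤ T be real numbers, let ν : [t₀,T] → [0,∞) be integrable, M ≥ 0, and let μ : [t₀,T] → ℝ be continuous. If (1/2)μ(t)² ≤ (1/2)M² + ∫_{t₀}^{t} ν(s)μ(s) ds for all t ∈ [t₀,T], then |μ(t)| ≤ M + ∫_{t₀}^{t} ν(s) ds for all t ∈ [t₀,T]. -/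
open scoped RealInnerProductSpace
open MeasureTheory Set

open Filter Topology in
/-- A continuous positive function whose squared increments are controlled by those of a monotone
function `N` grows at most as fast as `N`. -/
theorem sub_le_sub_of_sq_sub_sq_le {a b : ℝ} {z N : ℝ → ℝ}
    (hz : ContinuousOn z (Icc a b)) (hN : ContinuousOn N (Icc a b))
    (hz_pos : ∀ t ∈ Icc a b, 0 < z t) (hN_mono : MonotoneOn N (Icc a b))
    (h : ∀ s ∈ Icc a b, ∀ t ∈ Icc a b, s ≤ t → z t ^ 2 - z s ^ 2 ≤ 2 * z t * (N t - N s)) :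
    ∀ t ∈ Icc a b, z t - z a ≤ N t - N a := by
  have key : ∀ ε > 0, ∀ t ∈ Icc a b, z t - z a ≤ (1 + ε) * (N t - N a) := by
    intro ε hε
    refine IsClosed.Icc_subset_of_forall_exists_gt
      (s := {t | z t - z a ≤ (1 + ε) * (N t - N a)}) ?_ (by simp) ?_
    · rw [inter_comm]
      exact isClosed_Icc.isClosed_le (hz.sub continuousOn_const)
        (continuousOn_const.mul (hN.sub continuousOn_const))
    · rintro x ⟨hx, hxa, hxb⟩ y hxy
      have hx_mem : x ∈ Icc a b := ⟨hxa, hxb.le⟩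
      have hzx := hz_pos x hx_mem
      have hnear : ∀ᶠ t in 𝓝[>] x, z t < (1 + ε) * z x := by
        have hcont : Tendsto z (𝓝[>] x) (𝓝 (z x)) :=
          ((hz x hx_mem).mono_left
            (nhdsWithin_mono x (Ioc_subset_Icc_self.trans (Icc_subset_Icc_left hxa)))).mono_left
            (nhdsWithin_Ioc_eq_nhdsGT hxb).ge
        exact hcont.eventually_lt_const (by nlinarith)
      obtain ⟨t, ht, htx, htm⟩ :=
        (hnear.and (Ioc_mem_nhdsGT (lt_min hxy hxb))).exists
      have ht_mem : t ∈ Icc a b := ⟨hxa.trans htx.le, htm.trans (min_le_right _ _)⟩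
      refine ⟨t, ?_, htx, htm.trans (min_le_left _ _)⟩
      have hzt := hz_pos t ht_mem
      have hinc := h x hx_mem t ht_mem htx.le
      have hNt := sub_nonneg.2 (hN_mono hx_mem ht_mem htx.le)
      have hstep : z t - z x ≤ (1 + ε) * (N t - N x) := by
        refine le_of_mul_le_mul_right ?_ (add_pos hzt hzx)
        have hfac : 2 * z t ≤ (1 + ε) * (z t + z x) := by nlinarith
        nlinarith [mul_le_mul_of_nonneg_right hfac hNt]
      simp only [mem_ofPred_eq] at hx ⊢
      linarith
  intro t ht
  have hlim : Tendsto (fun ε : ℝ => (1 + ε) * (N t - N a)) (𝓝[>] 0) (𝓝 (N t - N a)) := by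
    refine (Continuous.tendsto' (by fun_prop) 0 _ (by simp)).mono_left nhdsWithin_le_nhds
  exact ge_of_tendsto hlim (eventually_mem_nhdsWithin.mono fun ε hε => key ε hε t ht)

theorem gronwall_quadratic_bound
    (t₀ T : ℝ) (hT : t₀ ≤ T)
    (ν : ℝ → ℝ) (hν_nonneg : ∀ t ∈ Icc t₀ T, 0 ≤ ν t)
    (hν_int : IntegrableOn ν (Icc t₀ T))
    (M : ℝ) (hM : 0 ≤ M)
    (μ : ℝ → ℝ) (hμ_cont : ContinuousOn μ (Icc t₀ T))
    (hineq : ∀ t ∈ Icc t₀ T,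
      (1 / 2) * μ t ^ 2 ≤ (1 / 2) * M ^ 2 + ∫ s in t₀..t, ν s * μ s) :
    ∀ t ∈ Icc t₀ T, |μ t| ≤ M + ∫ s in t₀..t, ν s := by
  have hii : ∀ {f : ℝ → ℝ}, IntegrableOn f (Icc t₀ T) → ∀ s ∈ Icc t₀ T, ∀ t ∈ Icc t₀ T,
      IntervalIntegrable f volume s t := fun hf s hs t ht =>
    (hf.mono_set (OrdConnected.uIcc_subset ordConnected_Icc hs ht)).intervalIntegrable
  have hcont : ∀ {f : ℝ → ℝ}, IntegrableOn f (Icc t₀ T) →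
      ContinuousOn (fun t => ∫ s in t₀..t, f s) (Icc t₀ T) := fun hf => by
    rw [← uIcc_of_le hT] at hf ⊢
    exact intervalIntegral.continuousOn_primitive_interval hf
  have hincr : ∀ {f : ℝ → ℝ}, IntegrableOn f (Icc t₀ T) → ∀ s ∈ Icc t₀ T, ∀ t ∈ Icc t₀ T,
      (∫ r in t₀..t, f r) - ∫ r in t₀..s, f r = ∫ r in s..t, f r := fun hf s hs t ht =>
    intervalIntegral.integral_interval_sub_left
      (hii hf _ (left_mem_Icc.2 hT) _ ht) (hii hf _ (left_mem_Icc.2 hT) _ hs)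
  have hint : IntegrableOn (fun s => ν s * μ s) (Icc t₀ T) :=
    hν_int.mul_continuousOn hμ_cont isCompact_Icc
  have hint_abs : IntegrableOn (fun s => ν s * |μ s|) (Icc t₀ T) :=
    hν_int.mul_continuousOn hμ_cont.abs isCompact_Icc
  have hsub : ∀ s ∈ Icc t₀ T, ∀ t ∈ Icc t₀ T, ∀ r ∈ Icc s t, r ∈ Icc t₀ T :=
    fun s hs t ht r hr => ⟨hs.1.trans hr.1, hr.2.trans ht.2⟩
  have hmono : ∀ {f : ℝ → ℝ}, IntegrableOn f (Icc t₀ T) → (∀ t ∈ Icc t₀ T, 0 ≤ f t) →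
      MonotoneOn (fun t => ∫ s in t₀..t, f s) (Icc t₀ T) := fun hf hf0 s hs t ht hst =>
    sub_nonneg.1 <| (hincr hf s hs t ht).symm ▸
      intervalIntegral.integral_nonneg hst fun r hr => hf0 r (hsub s hs t ht r hr)
  have habs_nonneg : ∀ t ∈ Icc t₀ T, 0 ≤ ν t * |μ t| :=
    fun t ht => mul_nonneg (hν_nonneg t ht) (abs_nonneg _)
  intro t ht
  refine le_of_forall_pos_le_add fun ε hε => ?_
  set z : ℝ → ℝ := fun t => √((M + ε) ^ 2 + 2 * ∫ s in t₀..t, ν s * |μ s|) with hz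
  have hG_nonneg : ∀ t ∈ Icc t₀ T, 0 ≤ ∫ s in t₀..t, ν s * |μ s| := fun t ht =>
    intervalIntegral.integral_nonneg ht.1 fun r hr =>
      habs_nonneg r (hsub t₀ (left_mem_Icc.2 hT) t ht r hr)
  have hrad_pos : ∀ t ∈ Icc t₀ T, 0 < (M + ε) ^ 2 + 2 * ∫ s in t₀..t, ν s * |μ s| := fun t ht => by
    have := hG_nonneg t ht
    positivity
  have hz_sq : ∀ t ∈ Icc t₀ T, z t ^ 2 = (M + ε) ^ 2 + 2 * ∫ s in t₀..t, ν s * |μ s| :=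
    fun t ht => Real.sq_sqrt (hrad_pos t ht).le
  have hz_mono : MonotoneOn z (Icc t₀ T) := fun s hs t ht hst =>
    Real.sqrt_le_sqrt (by linarith [hmono hint_abs habs_nonneg hs ht hst])
  have hμz : ∀ t ∈ Icc t₀ T, |μ t| ≤ z t := fun t ht => by
    refine Real.abs_le_sqrt ?_
    have hle : ∫ s in t₀..t, ν s * μ s ≤ ∫ s in t₀..t, ν s * |μ s| :=
      intervalIntegral.integral_mono_on ht.1 (hii hint _ (left_mem_Icc.2 hT) _ ht)
        (hii hint_abs _ (left_mem_Icc.2 hT) _ ht) fun r hr =>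
        mul_le_mul_of_nonneg_left (le_abs_self _)
          (hν_nonneg r (hsub t₀ (left_mem_Icc.2 hT) t ht r hr))
    nlinarith [hineq t ht]
  have hgrowth := sub_le_sub_of_sq_sub_sq_le (z := z) (N := fun t => ∫ s in t₀..t, ν s)
    (continuousOn_const.add (continuousOn_const.mul (hcont hint_abs))).sqrt (hcont hν_int)
    (fun t ht => Real.sqrt_pos.2 (hrad_pos t ht)) (hmono hν_int hν_nonneg)
    (fun s hs t ht hst => by
      have hle : ∫ r in s..t, ν r * |μ r| ≤ ∫ r in s..t, ν r * z t :=
        intervalIntegral.integral_mono_on hst (hii hint_abs s hs t ht)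
          ((hii hν_int s hs t ht).mul_const _) fun r hr =>
          have hr' := hsub s hs t ht r hr
          mul_le_mul_of_nonneg_left ((hμz r hr').trans (hz_mono hr' ht hr.2)) (hν_nonneg r hr')
      rw [intervalIntegral.integral_mul_const] at hle
      rw [hz_sq t ht, hz_sq s hs, hincr hν_int s hs t ht]
      linarith [hincr hint_abs s hs t ht]) t ht
  have hz_left : z t₀ = M + ε := by
    simp [hz, Real.sqrt_sq (add_nonneg hM hε.le)]
  simp only [intervalIntegral.integral_same, hz_left] at hgrowth
  linarith [hμz t ht]
end
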